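/- arXiv:0903.0459 — 3 statements merged into one kernel-verified Lean document; each statement's English description precedes it below -/
import Mathlib

section
/- Let X ⊆ ℝ, let f : X → X be Borel measurable, and let μ be an f-invariant ergodic Borel probability measure on X. Then the Kolmogorov–Sinai entropy does not exceed the permutation entropy: h_μ(f) ≤ h*_μ(f). -/
open MeasureTheory Filter Set Function
open scoped Classical ENNReal Topology

noncomputable section

/-- `ordIdx f d l x` is the inversion number `i_{d,l}(x)`, the `l`-th entry of the
ordinal pattern of order `d` realized by `x`:
`i_{d,l}(x) = #{r ∈ {0,…,l-1} : f^[d-r] x ≤ f^[d-l] x}`. -/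
def ordIdx {X : Set ℝ} (f : X → X) (d l : ℕ) (x : X) : ℕ :=
  ((Finset.range l).filter (fun r => f^[d - r] x ≤ f^[d - l] x)).card

/-- The partition `P_d = {P_i : i ∈ I_d}` of `X` into the sets of points realizing the
same ordinal pattern of order `d`, where an ordinal pattern `i ∈ I_d = ∏_{l=1}^d {0,…,l}`
is encoded as a dependent function `i : ∀ l : Fin d, Fin (l+2)` (so that `i l` is the
entry `i_{l+1} ∈ {0,…,l+1}`). -/
def patPartition {X : Set ℝ} (f : X → X) (d : ℕ) : Finset (Set X) :=
  Finset.image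
    (fun i : (∀ l : Fin d, Fin (l.val + 2)) =>
      {x : X | ∀ l : Fin d, ordIdx f d (l.val + 1) x = (i l).val})
    Finset.univ

/-- `𝒜` is a finite partition of `X` into Borel sets. -/
def IsFinPartition {X : Set ℝ} (𝒜 : Finset (Set X)) : Prop :=
  (∀ A ∈ 𝒜, MeasurableSet A) ∧
  (∀ A ∈ 𝒜, ∀ B ∈ 𝒜, A ≠ B → Disjoint A B) ∧
  ⋃₀ (𝒜 : Set (Set X)) = Set.univ

/-- The Shannon entropy `H(𝒜) = -∑_{A ∈ 𝒜} μ(A) ln μ(A)` of a finite partition `𝒜`. -/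
def partEntropy {X : Set ℝ} (μ : Measure X) (𝒜 : Finset (Set X)) : ℝ :=
  ∑ A ∈ 𝒜, Real.negMulLog (μ A).toReal

/-- The common refinement `⋁_{j=0}^{n-1} f^{-∘j}(𝒜)`, i.e. the partition of `X` into the
nonempty intersections `⋂_{j<n} f^{-∘j}(A_j)` with `A_j ∈ 𝒜`; it is the (unique up to
empty sets) partition generating the σ-algebra `⋁_{j=0}^{n-1} f^{-∘j}(𝒜)`. -/
def dynRefine {X : Set ℝ} (f : X → X) (𝒜 : Finset (Set X)) : ℕ → Finset (Set X)
  | 0 => {Set.univ}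
  | n + 1 =>
      ((dynRefine f 𝒜 n) ×ˢ (𝒜.image fun A => f^[n] ⁻¹' A)).image fun p => p.1 ∩ p.2

/-- `h_μ(f,𝒜) = lim_{n→∞} (1/n) H(⋁_{j=0}^{n-1} f^{-∘j}(𝒜))` (the limit exists and is
here expressed as a `limsup`). -/
def dynEntropy {X : Set ℝ} (μ : Measure X) (f : X → X) (𝒜 : Finset (Set X)) : ℝ :=
  Filter.limsup (fun n : ℕ => partEntropy μ (dynRefine f 𝒜 n) / n) Filter.atTop

/-- The Kolmogorov-Sinai entropy `h_μ(f) = sup {h_μ(f,𝒜) : 𝒜 finite Borel partition}`,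
as an extended nonnegative real. -/
def ksEntropy {X : Set ℝ} (μ : Measure X) (f : X → X) : ℝ≥0∞ :=
  ⨆ (𝒜 : Finset (Set X)) (_ : IsFinPartition 𝒜), ENNReal.ofReal (dynEntropy μ f 𝒜)

/-- The permutation entropy `h*_μ(f) = limsup_{d→∞} (1/d) H(P_d)`, as an extended
nonnegative real. -/
def permEntropy {X : Set ℝ} (μ : Measure X) (f : X → X) : ℝ≥0∞ :=
  Filter.limsup
    (fun d : ℕ => ENNReal.ofReal (partEntropy μ (patPartition f d)) / (d : ℝ≥0∞))
    Filter.atTop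

section FunctionEntropy

variable {Ω : Type*} [MeasurableSpace Ω] {μ : Measure Ω} {α β γ : Type*}

/-- The Shannon entropy of the partition into the fibres of `g`. -/
def fnEntropy [Fintype α] (μ : Measure Ω) (g : Ω → α) : ℝ :=
  ∑ a, Real.negMulLog (μ.real (g ⁻¹' {a}))

lemma fnEntropy_nonneg [Fintype α] [IsProbabilityMeasure μ] (g : Ω → α) : 0 ≤ fnEntropy μ g :=
  Finset.sum_nonneg fun _ _ => Real.negMulLog_nonneg measureReal_nonneg measureReal_le_one

lemma negMulLog_sum_le {s : Finset α} {p : α → ℝ} (hp : ∀ a ∈ s, 0 ≤ p a) :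
    Real.negMulLog (∑ a ∈ s, p a) ≤ ∑ a ∈ s, Real.negMulLog (p a) := by
  rw [Real.negMulLog, neg_mul, Finset.sum_mul, ← Finset.sum_neg_distrib]
  refine Finset.sum_le_sum fun a ha => ?_
  rcases (hp a ha).eq_or_lt with h | h
  · simp [← h]
  · have := Real.log_le_log h (Finset.single_le_sum hp ha)
    rw [Real.negMulLog]
    nlinarith

/-- Conditional mutual information is nonnegative: the version for a fixed value of the
conditioning variable. -/
lemma sum_negMulLog_add_le [Fintype α] [Fintype β] {p : α → β → ℝ} (hp : ∀ a b, 0 ≤ p a b) :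
    ∑ a, ∑ b, Real.negMulLog (p a b) + Real.negMulLog (∑ a, ∑ b, p a b) ≤
      ∑ a, Real.negMulLog (∑ b, p a b) + ∑ b, Real.negMulLog (∑ a, p a b) := by
  set u : α → ℝ := fun a => ∑ b, p a b with hu
  set v : β → ℝ := fun b => ∑ a, p a b with hv
  set P : ℝ := ∑ a, u a with hP
  have hu0 : ∀ a, 0 ≤ u a := fun a => Finset.sum_nonneg fun b _ => hp a b
  have hv0 : ∀ b, 0 ≤ v b := fun b => Finset.sum_nonneg fun a _ => hp a b
  have hP0 : 0 ≤ P := Finset.sum_nonneg fun a _ => hu0 a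
  have hPv : P = ∑ b, v b := Finset.sum_comm
  have key : ∀ a b, p a b * (Real.log (u a) + Real.log (v b) - Real.log P - Real.log (p a b)) ≤
      u a * v b / P - p a b := by
    intro a b
    rcases (hp a b).eq_or_lt with h | h
    · rw [← h]
      have := div_nonneg (mul_nonneg (hu0 a) (hv0 b)) hP0
      simpa using this
    · have h1 : 0 < u a := h.trans_le (Finset.single_le_sum (fun b _ => hp a b) (Finset.mem_univ b))
      have h2 : 0 < v b := h.trans_le
        (Finset.single_le_sum (f := fun a => p a b) (fun a _ => hp a b) (Finset.mem_univ a))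
      have h3 : 0 < P := h1.trans_le (Finset.single_le_sum (fun a _ => hu0 a) (Finset.mem_univ a))
      have h4 : Real.log (u a) + Real.log (v b) - Real.log P - Real.log (p a b) =
          Real.log (u a * v b / P / p a b) := by
        rw [Real.log_div (by positivity) (by positivity),
          Real.log_div (by positivity) (by positivity), Real.log_mul (by positivity) (by positivity)]
      rw [h4]
      have h5 := Real.log_le_sub_one_of_pos (x := u a * v b / P / p a b) (by positivity)
      calc p a b * Real.log (u a * v b / P / p a b) ≤ p a b * (u a * v b / P / p a b - 1) := by
            gcongr
        _ = u a * v b / P - p a b := by field_simp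
  have hsum := Finset.sum_le_sum fun a (_ : a ∈ Finset.univ) =>
    Finset.sum_le_sum fun b (_ : b ∈ Finset.univ) => key a b
  have hR : ∑ a, ∑ b, (u a * v b / P - p a b) = 0 := by
    simp only [Finset.sum_sub_distrib, ← Finset.sum_div, ← Finset.mul_sum, ← hPv, ← Finset.sum_mul]
    rw [← hP]
    simp
  have hL : ∑ a, ∑ b, p a b * (Real.log (u a) + Real.log (v b) - Real.log P - Real.log (p a b)) =
      ∑ a, u a * Real.log (u a) + ∑ b, v b * Real.log (v b) - P * Real.log P -
        ∑ a, ∑ b, p a b * Real.log (p a b) := by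
    simp only [mul_sub, mul_add, Finset.sum_sub_distrib, Finset.sum_add_distrib]
    rw [Finset.sum_comm (f := fun a b => p a b * Real.log (v b))]
    simp only [← Finset.sum_mul]
    rfl
  rw [hL, hR] at hsum
  simp only [Real.negMulLog, neg_mul, Finset.sum_neg_distrib]
  linarith

lemma measurableSet_preimage_of_fibres [Finite α] {g : Ω → α}
    (hg : ∀ a, MeasurableSet (g ⁻¹' {a})) (s : Set α) : MeasurableSet (g ⁻¹' s) := by
  rw [← biUnion_of_singleton s, preimage_iUnion₂]
  exact MeasurableSet.biUnion s.to_countable fun a _ => hg a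

lemma measureReal_preimage_eq_sum [Fintype α] [IsFiniteMeasure μ] {g : Ω → α}
    (hg : ∀ a, MeasurableSet (g ⁻¹' {a})) {s : Finset α} {t : Set Ω}
    (ht : t = g ⁻¹' (s : Set α)) :
    μ.real t = ∑ a ∈ s, μ.real (g ⁻¹' {a}) := by
  rw [ht, ← biUnion_of_singleton (s : Set α), preimage_iUnion₂]
  exact measureReal_biUnion_finset
    (fun a _ b _ hab => Disjoint.preimage g (Set.disjoint_singleton.2 hab)) fun a _ => hg a

lemma measurableSet_fibre_comp [Finite α] {g : Ω → α} (hg : ∀ a, MeasurableSet (g ⁻¹' {a}))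
    (φ : α → β) (b : β) : MeasurableSet ((fun x => φ (g x)) ⁻¹' {b}) :=
  measurableSet_preimage_of_fibres hg (φ ⁻¹' {b})

lemma measurableSet_fibre_prodMk {g : Ω → α} {h : Ω → β} (hg : ∀ a, MeasurableSet (g ⁻¹' {a}))
    (hh : ∀ b, MeasurableSet (h ⁻¹' {b})) (c : α × β) :
    MeasurableSet ((fun x => (g x, h x)) ⁻¹' {c}) := by
  have : (fun x => (g x, h x)) ⁻¹' {c} = g ⁻¹' {c.1} ∩ h ⁻¹' {c.2} := by
    ext x; simp [Prod.ext_iff]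
  rw [this]
  exact (hg _).inter (hh _)

lemma measurableSet_fibre_pi [Finite α] {g : α → Ω → β}
    (hg : ∀ a b, MeasurableSet (g a ⁻¹' {b})) (w : α → β) :
    MeasurableSet ((fun x a => g a x) ⁻¹' {w}) := by
  have : (fun x a => g a x) ⁻¹' {w} = ⋂ a, g a ⁻¹' {w a} := by
    ext x; simp [funext_iff]
  rw [this]
  exact MeasurableSet.iInter fun a => hg _ _

/-- Entropy decreases under coarsening. -/
lemma fnEntropy_le_of_factorsThrough [Fintype α] [Fintype β] [IsProbabilityMeasure μ]
    {g : Ω → α} {h : Ω → β} (hg : ∀ a, MeasurableSet (g ⁻¹' {a})) (hgh : h.FactorsThrough g) :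
    fnEntropy μ h ≤ fnEntropy μ g := by
  have : Nonempty Ω := nonempty_of_isProbabilityMeasure μ
  have : Nonempty β := this.map h
  obtain ⟨φ, rfl⟩ := (factorsThrough_iff h).1 hgh
  unfold fnEntropy
  rw [← Finset.sum_fiberwise Finset.univ φ]
  refine Finset.sum_le_sum fun b _ => ?_
  rw [measureReal_preimage_eq_sum hg (s := Finset.univ.filter fun a => φ a = b) (by ext; simp)]
  exact negMulLog_sum_le fun _ _ => measureReal_nonneg

lemma fnEntropy_congr [Fintype α] [Fintype β] [IsProbabilityMeasure μ]
    {g : Ω → α} {h : Ω → β} (hg : ∀ a, MeasurableSet (g ⁻¹' {a}))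
    (hh : ∀ a, MeasurableSet (h ⁻¹' {a})) (hgh : ∀ x y, g x = g y ↔ h x = h y) :
    fnEntropy μ g = fnEntropy μ h :=
  (fnEntropy_le_of_factorsThrough hh fun _ _ e => (hgh _ _).2 e).antisymm
    (fnEntropy_le_of_factorsThrough hg fun _ _ e => (hgh _ _).1 e)

/-- Submodularity of entropy. -/
lemma fnEntropy_submodular [Fintype α] [Fintype β] [Fintype γ] [IsProbabilityMeasure μ]
    {g : Ω → α} {h : Ω → β} {k : Ω → γ} (hg : ∀ a, MeasurableSet (g ⁻¹' {a}))
    (hh : ∀ a, MeasurableSet (h ⁻¹' {a})) (hk : ∀ a, MeasurableSet (k ⁻¹' {a})) :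
    fnEntropy μ (fun x => (k x, g x, h x)) + fnEntropy μ k ≤
      fnEntropy μ (fun x => (k x, g x)) + fnEntropy μ (fun x => (k x, h x)) := by
  have hm := measurableSet_fibre_prodMk hk (measurableSet_fibre_prodMk hg hh)
  have e1 : ∀ c a, μ.real ((fun x => (k x, g x)) ⁻¹' {(c, a)}) =
      ∑ b, μ.real ((fun x => (k x, g x, h x)) ⁻¹' {(c, a, b)}) := by
    intro c a
    rw [measureReal_preimage_eq_sum hm (s := {c} ×ˢ {a} ×ˢ Finset.univ) (by ext; simp [eq_comm, and_comm])]
    simp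
  have e2 : ∀ c b, μ.real ((fun x => (k x, h x)) ⁻¹' {(c, b)}) =
      ∑ a, μ.real ((fun x => (k x, g x, h x)) ⁻¹' {(c, a, b)}) := by
    intro c b
    rw [measureReal_preimage_eq_sum hm (s := {c} ×ˢ Finset.univ ×ˢ {b}) (by ext; simp [eq_comm, and_comm])]
    simp
  have e3 : ∀ c, μ.real (k ⁻¹' {c}) =
      ∑ a, ∑ b, μ.real ((fun x => (k x, g x, h x)) ⁻¹' {(c, a, b)}) := by
    intro c
    rw [measureReal_preimage_eq_sum hm (s := {c} ×ˢ Finset.univ ×ˢ Finset.univ) (by ext; simp [eq_comm])]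
    rw [Finset.sum_product, Finset.sum_singleton, Finset.sum_product]
  unfold fnEntropy
  simp only [Fintype.sum_prod_type, e1, e2, e3]
  rw [← Finset.sum_add_distrib, ← Finset.sum_add_distrib]
  exact Finset.sum_le_sum fun c _ => sum_negMulLog_add_le fun _ _ => measureReal_nonneg

lemma fnEntropy_comp_measurePreserving [Fintype α] {T : Ω → Ω} (hT : MeasurePreserving T μ μ)
    {g : Ω → α} (hg : ∀ a, MeasurableSet (g ⁻¹' {a})) :
    fnEntropy μ (fun x => g (T x)) = fnEntropy μ g :=
  Finset.sum_congr rfl fun a _ => congrArg _ <|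
    hT.measureReal_preimage (hg a).nullMeasurableSet

/-- The `n`-itinerary of a point with respect to the labelling `g`. -/
def itinerary {Ω : Type*} (T : Ω → Ω) (g : Ω → α) (n : ℕ) (x : Ω) (j : Fin n) : α := g (T^[j] x)

lemma measurableSet_fibre_itinerary {T : Ω → Ω} (hT : Measurable T) {g : Ω → α}
    (hg : ∀ a, MeasurableSet (g ⁻¹' {a})) (n : ℕ) (w : Fin n → α) :
    MeasurableSet (itinerary T g n ⁻¹' {w}) :=
  measurableSet_fibre_pi (g := fun (j : Fin n) x => g (T^[j] x))
    (fun j a => (hT.iterate j) (hg a)) w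

lemma itinerary_succ_eq_iff {Ω : Type*} {T : Ω → Ω} {g : Ω → α} {n : ℕ} {x y : Ω} :
    itinerary T g (n + 1) x = itinerary T g (n + 1) y ↔
      itinerary T g n x = itinerary T g n y ∧ g (T^[n] x) = g (T^[n] y) := by
  simp [funext_iff, itinerary, Fin.forall_fin_succ']

/-- The entropy of the itinerary of `g` exceeds that of the itinerary of `h` by at most `n` times
the conditional entropy of `g` given `h`. -/
lemma fnEntropy_itinerary_le [Fintype α] [Fintype β] [IsProbabilityMeasure μ] {T : Ω → Ω}
    (hT : MeasurePreserving T μ μ) {g : Ω → α} {h : Ω → β}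
    (hg : ∀ a, MeasurableSet (g ⁻¹' {a})) (hh : ∀ a, MeasurableSet (h ⁻¹' {a})) (n : ℕ) :
    fnEntropy μ (itinerary T g n) ≤ fnEntropy μ (itinerary T h n) +
      n * (fnEntropy μ (fun x => (g x, h x)) - fnEntropy μ h) := by
  have hG := measurableSet_fibre_itinerary hT.measurable hg
  have hH := measurableSet_fibre_itinerary hT.measurable hh
  have main : fnEntropy μ (fun x => (itinerary T g n x, itinerary T h n x)) ≤
      fnEntropy μ (itinerary T h n) +
        n * (fnEntropy μ (fun x => (g x, h x)) - fnEntropy μ h) := by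
    induction n with
    | zero =>
      simp only [Nat.cast_zero, zero_mul, add_zero]
      exact (fnEntropy_congr (measurableSet_fibre_prodMk (hG 0) (hH 0)) (hH 0)
        fun x y => by simp [funext_iff]).le
    | succ n ih =>
      have hgn : ∀ a, MeasurableSet ((fun x => g (T^[n] x)) ⁻¹' {a}) :=
        fun a => hT.measurable.iterate n (hg a)
      have hhn : ∀ a, MeasurableSet ((fun x => h (T^[n] x)) ⁻¹' {a}) :=
        fun a => hT.measurable.iterate n (hh a)
      have hGH := measurableSet_fibre_prodMk (hG n) (hH n)
      have s1 := fnEntropy_submodular (μ := μ) hgn hGH hhn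
      have s2 := fnEntropy_submodular (μ := μ) (hG n) hhn (hH n)
      have c1 : fnEntropy μ (fun x => (itinerary T g (n + 1) x, itinerary T h (n + 1) x)) =
          fnEntropy μ (fun x => (h (T^[n] x), g (T^[n] x), itinerary T g n x, itinerary T h n x)) :=
        fnEntropy_congr (measurableSet_fibre_prodMk (hG _) (hH _))
          (measurableSet_fibre_prodMk hhn (measurableSet_fibre_prodMk hgn hGH)) fun x y => by
            simp only [Prod.mk.injEq, itinerary_succ_eq_iff]; tauto
      have c2 : fnEntropy μ (fun x => (h (T^[n] x), itinerary T g n x, itinerary T h n x)) =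
          fnEntropy μ (fun x => (itinerary T h n x, itinerary T g n x, h (T^[n] x))) :=
        fnEntropy_congr (measurableSet_fibre_prodMk hhn hGH)
          (measurableSet_fibre_prodMk (hH n) (measurableSet_fibre_prodMk (hG n) hhn)) fun x y => by
            simp only [Prod.mk.injEq]; tauto
      have c3 : fnEntropy μ (itinerary T h (n + 1)) =
          fnEntropy μ (fun x => (itinerary T h n x, h (T^[n] x))) :=
        fnEntropy_congr (hH _) (measurableSet_fibre_prodMk (hH n) hhn) fun x y => by
            simp only [Prod.mk.injEq, itinerary_succ_eq_iff]
      have c4 : fnEntropy μ (fun x => (itinerary T h n x, itinerary T g n x)) =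
          fnEntropy μ (fun x => (itinerary T g n x, itinerary T h n x)) :=
        fnEntropy_congr (measurableSet_fibre_prodMk (hH n) (hG n)) hGH fun x y => by
            simp only [Prod.mk.injEq]; tauto
      have c5 : fnEntropy μ (fun x => (h (T^[n] x), g (T^[n] x))) =
          fnEntropy μ (fun x => (g x, h x)) :=
        (fnEntropy_comp_measurePreserving (g := fun x => (h x, g x)) (hT.iterate n)
          (measurableSet_fibre_prodMk hh hg)).trans
          (fnEntropy_congr (measurableSet_fibre_prodMk hh hg) (measurableSet_fibre_prodMk hg hh)
            fun x y => by simp only [Prod.mk.injEq]; tauto)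
      have c6 : fnEntropy μ (fun x => h (T^[n] x)) = fnEntropy μ h :=
        fnEntropy_comp_measurePreserving (hT.iterate n) hh
      push_cast
      linarith
  exact (fnEntropy_le_of_factorsThrough (measurableSet_fibre_prodMk (hG n) (hH n))
    fun x y e => (Prod.mk.inj e).1).trans main

/-- The conditional entropy of `g` given `c i` tends to zero when `c i` tends to `g`. -/
lemma tendsto_fnEntropy_prodMk_sub [Fintype α] [IsProbabilityMeasure μ] {ι : Type*} {l : Filter ι}
    {g : Ω → α} {c : ι → Ω → α} (hc : Tendsto (fun i => μ.real {x | g x ≠ c i x}) l (𝓝 0)) :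
    Tendsto (fun i => fnEntropy μ (fun x => (g x, c i x)) - fnEntropy μ (c i)) l (𝓝 0) := by
  have bound : ∀ (s t : ι → Set Ω), (∀ i, ∀ x, g x = c i x → (x ∈ s i ↔ x ∈ t i)) →
      ∀ i, |μ.real (s i) - μ.real (t i)| ≤ μ.real {x | g x ≠ c i x} := by
    intro s t hst i
    have h1 : s i ⊆ t i ∪ {x | g x ≠ c i x} := fun x hx => by
      by_cases h : g x = c i x
      · exact Or.inl ((hst i x h).1 hx)
      · exact Or.inr h
    have h2 : t i ⊆ s i ∪ {x | g x ≠ c i x} := fun x hx => by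
      by_cases h : g x = c i x
      · exact Or.inl ((hst i x h).2 hx)
      · exact Or.inr h
    have h3 := (measureReal_mono (μ := μ) h1).trans (measureReal_union_le _ _)
    have h4 := (measureReal_mono (μ := μ) h2).trans (measureReal_union_le _ _)
    rw [abs_le]
    constructor <;> linarith
  have conv : ∀ (s : ι → Set Ω) (t : Set Ω), (∀ i, ∀ x, g x = c i x → (x ∈ s i ↔ x ∈ t)) →
      Tendsto (fun i => Real.negMulLog (μ.real (s i))) l (𝓝 (Real.negMulLog (μ.real t))) := by
    intro s t hst
    refine (Real.continuous_negMulLog.tendsto _).comp ?_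
    rw [tendsto_iff_dist_tendsto_zero]
    exact squeeze_zero (fun _ => dist_nonneg) (bound s (fun _ => t) hst) hc
  have h1 : Tendsto (fun i => fnEntropy μ (c i)) l (𝓝 (fnEntropy μ g)) :=
    tendsto_finsetSum _ fun a _ => conv _ _ fun i x hx => by simp [hx]
  have h2 : Tendsto (fun i => fnEntropy μ (fun x => (g x, c i x))) l
      (𝓝 (∑ p : α × α, Real.negMulLog (μ.real ((fun x => (g x, g x)) ⁻¹' {p})))) :=
    tendsto_finsetSum _ fun a _ => conv _ _ fun i x hx => by simp [hx]
  have h3 : ∑ p : α × α, Real.negMulLog (μ.real ((fun x => (g x, g x)) ⁻¹' {p})) =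
      fnEntropy μ g := by
    rw [Fintype.sum_prod_type]
    refine Finset.sum_congr rfl fun a _ => ?_
    rw [Finset.sum_eq_single a]
    · congr 2
      ext x; simp
    · intro b _ hb
      have : (fun x => (g x, g x)) ⁻¹' {(a, b)} = ∅ := by
        ext x
        simp only [mem_preimage, mem_singleton_iff, Prod.mk.injEq, mem_empty_iff_false, iff_false]
        rintro ⟨rfl, h⟩
        exact hb h.symm
      simp [this]
    · simp
  rw [h3] at h2
  simpa using h2.sub h1

end FunctionEntropy

section MeanErgodic

variable {Ω : Type*} [MeasurableSpace Ω] {μ : Measure Ω}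

lemma coeFn_birkhoffAverage_compMeasurePreserving {T : Ω → Ω} (hT : MeasurePreserving T μ μ)
    (g : Lp ℝ 2 μ) (n : ℕ) :
    (birkhoffAverage ℝ (Lp.compMeasurePreserving T hT) _root_.id n g : Lp ℝ 2 μ) =ᵐ[μ]
      birkhoffAverage ℝ T g n := by
  have hsum : (birkhoffSum (Lp.compMeasurePreserving T hT) _root_.id n g : Lp ℝ 2 μ) =ᵐ[μ]
      birkhoffSum T g n := by
    induction n with
    | zero => simpa using Lp.coeFn_zero ℝ 2 μ
    | succ n ih =>
      have h1 : ((Lp.compMeasurePreserving T hT)^[n] g : Lp ℝ 2 μ) =ᵐ[μ] g ∘ T^[n] := by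
        rw [Lp.compMeasurePreserving_iterate]
        exact Lp.coeFn_compMeasurePreserving g _
      rw [birkhoffSum_succ]
      filter_upwards [Lp.coeFn_add (birkhoffSum (Lp.compMeasurePreserving T hT) _root_.id n g)
        (_root_.id ((Lp.compMeasurePreserving T hT)^[n] g)), ih, h1] with x hx h2 h3
      rw [hx, birkhoffSum_succ, Pi.add_apply, h2]
      exact congrArg _ h3
  unfold birkhoffAverage
  filter_upwards [Lp.coeFn_smul (n : ℝ)⁻¹
    (birkhoffSum (Lp.compMeasurePreserving T hT) _root_.id n g), hsum] with x hx h2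
  rw [hx, Pi.smul_apply, h2]

/-- The mean ergodic theorem for indicator functions, with convergence in measure. -/
lemma Ergodic.tendstoInMeasure_birkhoffAverage_indicator [IsProbabilityMeasure μ] {T : Ω → Ω}
    (hT : Ergodic T μ) {s : Set Ω} (hs : MeasurableSet s) :
    TendstoInMeasure μ (fun n => birkhoffAverage ℝ T (s.indicator fun _ => (1 : ℝ)) n) atTop
      (fun _ => μ.real s) := by
  have hmp := hT.toMeasurePreserving
  set U : Lp ℝ 2 μ →L[ℝ] Lp ℝ 2 μ :=
    (Lp.compMeasurePreservingₗᵢ ℝ T hmp).toContinuousLinearMap with hU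
  have hU1 : ‖U‖ ≤ 1 := U.opNorm_le_bound zero_le_one fun x => by
    rw [one_mul]
    exact (Lp.norm_compMeasurePreserving x hmp).le
  set g : Lp ℝ 2 μ := indicatorConstLp 2 hs (measure_ne_top μ s) 1 with hg
  set e : Lp ℝ 2 μ := indicatorConstLp 2 MeasurableSet.univ (measure_ne_top μ univ) 1 with he
  set K := U.eqLocus (1 : Lp ℝ 2 μ →L[ℝ] Lp ℝ 2 μ) with hK
  have hlim := U.tendsto_birkhoffAverage_orthogonalProjection hU1 g
  set p := K.orthogonalProjectionOnto g with hp
  have hpU : Lp.compMeasurePreserving T hmp (p : Lp ℝ 2 μ) = p := p.2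
  obtain ⟨c, hc⟩ : ∃ c, (p : Lp ℝ 2 μ) =ᵐ[μ] const Ω c := by
    refine hT.ae_eq_const_of_ae_eq_comp_ae (Lp.aestronglyMeasurable _) ?_
    have := Lp.coeFn_compMeasurePreserving (p : Lp ℝ 2 μ) hmp
    rw [hpU] at this
    exact this.symm
  have heK : e ∈ K := by
    change Lp.compMeasurePreserving T hmp e = e
    rw [he, Lp.indicatorConstLp_compMeasurePreserving]
    rfl
  have hcs : c = μ.real s := by
    have h1 : inner ℝ e (p : Lp ℝ 2 μ) = inner ℝ e g := by
      have : inner ℝ (g - (p : Lp ℝ 2 μ)) e = 0 := K.starProjection_inner_eq_zero g e heK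
      rw [real_inner_comm, inner_sub_right] at this
      linarith
    rw [he, L2.inner_indicatorConstLp_one, L2.inner_indicatorConstLp_one, setIntegral_univ,
      setIntegral_univ, integral_congr_ae hc, hg, integral_congr_ae indicatorConstLp_coeFn,
      integral_indicator_const _ hs] at h1
    simpa using h1
  refine TendstoInMeasure.congr (fun n => ?_) (hc.trans (by rw [hcs]; rfl))
    (tendstoInMeasure_of_tendsto_Lp hlim)
  refine (coeFn_birkhoffAverage_compMeasurePreserving hmp g n).trans ?_
  have h1 : ∀ᵐ x ∂μ, ∀ k, g (T^[k] x) = s.indicator (fun _ => (1 : ℝ)) (T^[k] x) :=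
    ae_all_iff.2 fun k => (hmp.iterate k).quasiMeasurePreserving.ae indicatorConstLp_coeFn
  filter_upwards [h1] with x hx
  simp only [birkhoffAverage, birkhoffSum, hx]

end MeanErgodic

section Approximation

/-- A quantile of a probability measure on the line, located to the right of a given point. -/
lemma exists_quantile_gt (ν : Measure ℝ) [IsProbabilityMeasure ν] {a δ : ℝ} (hδ : 0 < δ)
    (h1 : ν.real (Iic a) + δ < 1) :
    ∃ b, a < b ∧ ν.real (Iic a) + δ ≤ ν.real (Iic b) ∧ ν.real (Iio b) ≤ ν.real (Iic a) + δ := by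
  set F := ProbabilityTheory.cdf ν with hF
  have hFr : ∀ x, F x = ν.real (Iic x) := ProbabilityTheory.cdf_eq_real ν
  set c := ν.real (Iic a) + δ with hc
  set T : Set ℝ := {b | c ≤ F b} with hT
  have hTa : ∀ b ∈ T, a ≤ b := by
    intro b hb
    by_contra! hba
    have h2 : F b ≤ F a := F.mono hba.le
    rw [hFr a] at h2
    have h3 : c ≤ F b := hb
    linarith
  have hTne : T.Nonempty :=
    (((ProbabilityTheory.tendsto_cdf_atTop ν).eventually_const_lt h1).exists).imp fun _ h => h.le
  have hTbdd : BddBelow T := ⟨a, hTa⟩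
  have hge : c ≤ F (sInf T) := by
    have hr : Tendsto F (𝓝[>] sInf T) (𝓝 (F (sInf T))) :=
      (F.right_continuous (sInf T)).mono_left (nhdsWithin_mono _ Ioi_subset_Ici_self)
    refine ge_of_tendsto hr ?_
    filter_upwards [self_mem_nhdsWithin] with x hx
    obtain ⟨b, hb, hbx⟩ := (csInf_lt_iff hTbdd hTne).1 hx
    exact le_trans hb (F.mono hbx.le)
  refine ⟨sInf T, lt_of_le_of_ne (le_csInf hTne hTa) ?_, by rw [← hFr]; exact hge, ?_⟩
  · intro h
    rw [← h, hFr] at hge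
    linarith
  · obtain ⟨u, hu, hlt, hlim⟩ := exists_seq_strictMono_tendsto (sInf T)
    refine ENNReal.toReal_le_of_le_ofReal (by positivity) ?_
    rw [← iUnion_Iic_eq_Iio_of_lt_of_tendsto hlt hlim,
      Monotone.measure_iUnion fun i j h => Iic_subset_Iic.2 (hu.monotone h)]
    refine iSup_le fun i => ?_
    rw [← ofReal_measureReal]
    refine ENNReal.ofReal_le_ofReal ?_
    have h1 : u i ∉ T := fun h => absurd (csInf_le hTbdd h) (not_le.2 (hlt i))
    have h2 : F (u i) < c := not_le.1 h1
    rw [hFr] at h2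
    exact h2.le

variable {X : Set ℝ} {f : X → X} {μ : Measure X}

/-- The comparisons of a point with the first `n` points of its orbit. -/
def orbitCmp (f : X → X) (n : ℕ) (x : X) (t : Fin n) : Prop := f^[t] x ≤ x

lemma measurableSet_fibre_orbitCmp (hf : Measurable f) (n : ℕ) (w : Fin n → Prop) :
    MeasurableSet (orbitCmp f n ⁻¹' {w}) := by
  refine measurableSet_fibre_pi (g := fun (t : Fin n) (x : X) => f^[t] x ≤ x) (fun t p => ?_) w
  have h : MeasurableSet {x | f^[t] x ≤ x} := measurableSet_le (hf.iterate t) measurable_id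
  by_cases hp : p
  · convert h using 1
    ext x; simp [hp]
  · convert h.compl using 1
    ext x; simp [hp]

/-- Sets which can be approximated in measure by sets defined in terms of finitely many comparisons
of a point with its orbit. -/
def CmpApprox (f : X → X) (μ : Measure X) (B : Set X) : Prop :=
  ∀ ε : ℝ, 0 < ε → ∃ (n : ℕ) (S : Set (Fin n → Prop)),
    μ.real (symmDiff B (orbitCmp f n ⁻¹' S)) < ε

lemma exists_orbitCmp_preimage_eq {n m : ℕ} (h : n ≤ m) (S : Set (Fin n → Prop)) :
    ∃ S' : Set (Fin m → Prop), orbitCmp f m ⁻¹' S' = orbitCmp f n ⁻¹' S :=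
  ⟨(fun w t => w (Fin.castLE h t)) ⁻¹' S, rfl⟩

lemma CmpApprox.compl {B : Set X} (hB : CmpApprox f μ B) : CmpApprox f μ Bᶜ := fun ε hε =>
  let ⟨n, S, h⟩ := hB ε hε
  ⟨n, Sᶜ, by rwa [preimage_compl, compl_symmDiff_compl]⟩

lemma cmpApprox_empty : CmpApprox f μ ∅ := fun ε hε => ⟨0, ∅, by simpa using hε⟩

lemma CmpApprox.union [IsFiniteMeasure μ] {B C : Set X} (hB : CmpApprox f μ B)
    (hC : CmpApprox f μ C) : CmpApprox f μ (B ∪ C) := by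
  intro ε hε
  obtain ⟨n, S, hS⟩ := hB (ε / 2) (by positivity)
  obtain ⟨m, S', hS'⟩ := hC (ε / 2) (by positivity)
  obtain ⟨U, hU⟩ := exists_orbitCmp_preimage_eq (f := f) (le_max_left n m) S
  obtain ⟨V, hV⟩ := exists_orbitCmp_preimage_eq (f := f) (le_max_right n m) S'
  refine ⟨max n m, U ∪ V, ?_⟩
  rw [preimage_union, hU, hV]
  have := (measureReal_mono (μ := μ) (union_symmDiff_union_subset (s := B) (t := C)
    (u := orbitCmp f n ⁻¹' S) (v := orbitCmp f m ⁻¹' S'))).trans (measureReal_union_le _ _)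
  linarith

lemma CmpApprox.iUnion [IsFiniteMeasure μ] {B : ℕ → Set X} (hB : ∀ i, CmpApprox f μ (B i))
    (hm : ∀ i, MeasurableSet (B i)) : CmpApprox f μ (⋃ i, B i) := by
  have hacc : ∀ N, CmpApprox f μ (accumulate B N) := by
    intro N
    induction N with
    | zero => simpa using hB 0
    | succ N ih => rw [accumulate_succ]; exact ih.union (hB _)
  intro ε hε
  have hlim : Tendsto (fun N => μ.real (accumulate B N)) atTop (𝓝 (μ.real (⋃ i, B i))) :=
    (ENNReal.tendsto_toReal (measure_ne_top _ _)).comp tendsto_measure_iUnion_accumulate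
  obtain ⟨N, hN⟩ := (hlim.eventually_const_lt
    (show μ.real (⋃ i, B i) - ε / 2 < _ by linarith)).exists
  obtain ⟨n, S, hS⟩ := hacc N (ε / 2) (by positivity)
  refine ⟨n, S, (measureReal_symmDiff_le (μ := μ) (t := accumulate B N) _).trans_lt ?_⟩
  have hsub : accumulate B N ⊆ ⋃ i, B i := accumulate_subset_iUnion N
  have hd : μ.real (symmDiff (⋃ i, B i) (accumulate B N)) =
      μ.real (⋃ i, B i) - μ.real (accumulate B N) := by
    rw [symmDiff_of_ge hsub]
    exact measureReal_sdiff hsub (MeasurableSet.biUnion (to_countable _) fun i _ => hm i)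
  linarith

lemma cmpApprox_Iic [IsProbabilityMeasure μ] (hf : Ergodic f μ) (a : ℝ) :
    CmpApprox f μ {x | (x : ℝ) ≤ a} := by
  intro ε hε
  have hcoe : Measurable ((↑) : X → ℝ) := measurable_subtype_coe
  set ν := μ.map ((↑) : X → ℝ) with hν
  have : IsProbabilityMeasure ν := Measure.isProbabilityMeasure_map hcoe.aemeasurable
  have hνr : ∀ s, MeasurableSet s → ν.real s = μ.real ((↑) ⁻¹' s) := fun s hs =>
    map_measureReal_apply hcoe hs
  set δ := ε / 4 with hδ
  have hδ0 : 0 < δ := by positivity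
  by_cases h1 : ν.real (Iic a) + δ < 1
  swap
  · refine ⟨0, univ, ?_⟩
    have h2 : symmDiff {x : X | (x : ℝ) ≤ a} (orbitCmp f 0 ⁻¹' univ) = (↑) ⁻¹' (Iic a)ᶜ := by
      rw [preimage_univ, ← top_eq_univ, symmDiff_top]
      rfl
    rw [h2, ← hνr _ measurableSet_Iic.compl, probReal_compl_eq_one_sub measurableSet_Iic]
    linarith
  obtain ⟨b, hab, hb1, hb2⟩ := exists_quantile_gt ν hδ0 h1
  set A : ℝ → Set X := fun c => {x | (x : ℝ) ≤ c} with hA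
  have hAm : ∀ c, MeasurableSet (A c) := fun c => hcoe measurableSet_Iic
  have hAν : ∀ c, μ.real (A c) = ν.real (Iic c) := fun c => (hνr _ measurableSet_Iic).symm
  set avg : ℝ → ℕ → X → ℝ := fun c n => birkhoffAverage ℝ f ((A c).indicator fun _ => (1 : ℝ)) n
  have hbad : ∀ c, ∀ᶠ n in atTop, μ.real {x | δ / 2 ≤ dist (avg c n x) (μ.real (A c))} < δ :=
    fun c => (tendstoInMeasure_iff_measureReal_dist.1
      (hf.tendstoInMeasure_birkhoffAverage_indicator (hAm c)) (δ / 2)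
        (by positivity)).eventually_lt_const hδ0
  obtain ⟨n, hna, hnb⟩ := ((hbad a).and (hbad b)).exists
  set cnt : (Fin n → Prop) → ℝ := fun w => (n : ℝ)⁻¹ * ∑ t, if w t then 1 else 0 with hcnt
  have havg : ∀ c x, avg c n x = (n : ℝ)⁻¹ * ∑ t : Fin n, if f^[t] x ∈ A c then 1 else 0 := by
    intro c x
    simp only [avg, birkhoffAverage, birkhoffSum, smul_eq_mul, Finset.sum_range, indicator_apply]
  have hle : ∀ x : X, (x : ℝ) ≤ a → cnt (orbitCmp f n x) ≤ avg a n x := by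
    intro x hx
    rw [havg]
    refine mul_le_mul_of_nonneg_left (Finset.sum_le_sum fun t _ => ?_) (by positivity)
    by_cases h : f^[t] x ≤ x
    · have h' : f^[t] x ∈ A a := le_trans (Subtype.coe_le_coe.2 h) hx
      simp [orbitCmp, h, h']
    · simp only [orbitCmp, h, if_false]
      split_ifs <;> norm_num
  have hge : ∀ x : X, b ≤ x → avg b n x ≤ cnt (orbitCmp f n x) := by
    intro x hx
    rw [havg]
    refine mul_le_mul_of_nonneg_left (Finset.sum_le_sum fun t _ => ?_) (by positivity)
    by_cases h : f^[t] x ∈ A b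
    · have h' : f^[t] x ≤ x := Subtype.coe_le_coe.1 (le_trans h hx)
      simp [orbitCmp, h, h']
    · simp only [h, if_false]
      split_ifs <;> norm_num
  refine ⟨n, {w | cnt w < ν.real (Iic a) + δ / 2}, ?_⟩
  have hsub : symmDiff (A a) (orbitCmp f n ⁻¹' {w | cnt w < ν.real (Iic a) + δ / 2}) ⊆
      ({x | δ / 2 ≤ dist (avg a n x) (μ.real (A a))} ∪
        {x | δ / 2 ≤ dist (avg b n x) (μ.real (A b))}) ∪ (↑) ⁻¹' (Iio b \ Iic a) := by
    intro x hx
    by_contra hcon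
    simp only [mem_union, mem_ofPred_eq, not_or, not_le, mem_preimage, hAν, Real.dist_eq, abs_lt] at hcon
    obtain ⟨⟨⟨ha1, ha2⟩, hb3, hb4⟩, hmid⟩ := hcon
    rcases hx with ⟨hxa, hxS⟩ | ⟨hxS, hxa⟩
    · have := hle x hxa
      exact hxS (show cnt _ < _ by linarith)
    · have hbx : b ≤ x := by
        by_contra! h
        exact hmid ⟨h, hxa⟩
      have := hge x hbx
      have hxS' : cnt (orbitCmp f n x) < ν.real (Iic a) + δ / 2 := hxS
      linarith
  have hmid : μ.real (((↑) : X → ℝ) ⁻¹' (Iio b \ Iic a)) ≤ δ := by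
    rw [← hνr _ (measurableSet_Iio.diff measurableSet_Iic),
      measureReal_sdiff (Iic_subset_Iio.2 hab) measurableSet_Iic]
    linarith
  have := (measureReal_mono (μ := μ) hsub).trans (measureReal_union_le _ _)
  have := measureReal_union_le (μ := μ) {x | δ / 2 ≤ dist (avg a n x) (μ.real (A a))}
    {x | δ / 2 ≤ dist (avg b n x) (μ.real (A b))}
  change μ.real (symmDiff (A a) _) < ε
  linarith

lemma cmpApprox_of_measurableSet [IsProbabilityMeasure μ] (hf : Ergodic f μ) {B : Set X}
    (hB : MeasurableSet B) : CmpApprox f μ B := by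
  obtain ⟨t, ht, rfl⟩ := hB
  have hcoe : Measurable ((↑) : X → ℝ) := measurable_subtype_coe
  rw [BorelSpace.measurable_eq (α := ℝ), borel_eq_generateFrom_Iic ℝ] at ht
  refine MeasurableSpace.generateFrom_induction (range Iic)
    (fun t _ => CmpApprox f μ ((↑) ⁻¹' t)) ?_ ?_ ?_ ?_ t ht
  · rintro _ ⟨a, rfl⟩ _
    exact cmpApprox_Iic hf a
  · simpa using cmpApprox_empty
  · intro t _ h
    simpa using h.compl
  · intro s hs h
    rw [preimage_iUnion]
    refine CmpApprox.iUnion h fun i => hcoe ?_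
    rw [BorelSpace.measurable_eq (α := ℝ), borel_eq_generateFrom_Iic ℝ]
    exact hs i

/-- Finite labellings are approximated in measure by functions of finitely many comparisons of a
point with its orbit. -/
lemma exists_orbitCmp_approx [IsProbabilityMeasure μ] (hf : Ergodic f μ) {α : Type*} [Fintype α]
    {g : X → α} (hg : ∀ a, MeasurableSet (g ⁻¹' {a})) {ε : ℝ} (hε : 0 < ε) :
    ∃ (n : ℕ) (ψ : (Fin n → Prop) → α), μ.real {x | g x ≠ ψ (orbitCmp f n x)} < ε := by
  have : Nonempty α := (nonempty_of_isProbabilityMeasure μ).map g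
  choose n S hS using fun a => cmpApprox_of_measurableSet hf (hg a)
    (ε / (Fintype.card α + 1)) (by positivity)
  choose S' hS' using fun a =>
    exists_orbitCmp_preimage_eq (f := f) (Finset.le_sup (f := n) (Finset.mem_univ a)) (S a)
  refine ⟨Finset.univ.sup n, fun w => Classical.epsilon fun a => w ∈ S' a, ?_⟩
  have hsub : {x | g x ≠ Classical.epsilon fun a => orbitCmp f (Finset.univ.sup n) x ∈ S' a} ⊆
      ⋃ a, symmDiff (g ⁻¹' {a}) (orbitCmp f (n a) ⁻¹' S a) := by
    intro x hx
    by_contra hcon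
    simp only [mem_iUnion, not_exists, mem_symmDiff, not_or, not_and, not_not, mem_preimage,
      mem_singleton_iff] at hcon
    have hiff : ∀ a, orbitCmp f (Finset.univ.sup n) x ∈ S' a ↔ g x = a := fun a => by
      have : orbitCmp f (Finset.univ.sup n) x ∈ S' a ↔ orbitCmp f (n a) x ∈ S a :=
        Set.ext_iff.1 (hS' a) x
      rw [this]
      exact ⟨(hcon a).2, (hcon a).1⟩
    apply hx
    simp only [hiff]
    exact Classical.epsilon_spec (p := fun a => g x = a) ⟨_, rfl⟩
  calc μ.real {x | g x ≠ Classical.epsilon fun a => orbitCmp f (Finset.univ.sup n) x ∈ S' a}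
      ≤ ∑ a, μ.real (symmDiff (g ⁻¹' {a}) (orbitCmp f (n a) ⁻¹' S a)) :=
        (measureReal_mono hsub).trans (measureReal_iUnion_fintype_le _)
    _ ≤ ∑ _a : α, ε / (Fintype.card α + 1) := Finset.sum_le_sum fun a _ => (hS a).le
    _ < ε := by
        rw [Finset.sum_const, Finset.card_univ, nsmul_eq_mul, mul_div_assoc',
          div_lt_iff₀ (by positivity)]
        nlinarith

end Approximation

section OrdinalPatterns

/-- The inversion numbers of a finite sequence in a linear order determine its order relations. -/
lemma le_iff_le_of_card_eq {α β : Type*} [LinearOrder α] [LinearOrder β] {z : ℕ → α} {w : ℕ → β}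
    {d : ℕ} (h : ∀ l, 1 ≤ l → l ≤ d →
      ((Finset.range l).filter fun r => z r ≤ z l).card =
        ((Finset.range l).filter fun r => w r ≤ w l).card)
    {l r : ℕ} (hl : l ≤ d) (hr : r < l) : z r ≤ z l ↔ w r ≤ w l := by
  induction l using Nat.strong_induction_on generalizing r with
  | _ l ih =>
    have hcmp : ∀ a b, a < b → b < l → (z a ≤ z b ↔ w a ≤ w b) :=
      fun a b hab hb => ih b hb (hb.le.trans hl) hab
    set D := (Finset.range l).filter fun r => z r ≤ z l with hD
    set D' := (Finset.range l).filter fun r => w r ≤ w l with hD'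
    have hcard : D.card = D'.card := h l (by omega) hl
    have hnest : D ⊆ D' ∨ D' ⊆ D := by
      by_contra! hcon
      obtain ⟨h1, h2⟩ := hcon
      obtain ⟨a, ha, ha'⟩ := Finset.not_subset.1 h1
      obtain ⟨b, hb, hb'⟩ := Finset.not_subset.1 h2
      simp only [hD, hD', Finset.mem_filter, Finset.mem_range, not_and, not_le] at ha ha' hb hb'
      have hz := ha.2.trans_lt (hb' hb.1)
      have hw := hb.2.trans_lt (ha' ha.1)
      rcases lt_trichotomy a b with hab | rfl | hab
      · exact absurd ((hcmp a b hab hb.1).1 hz.le) (not_le.2 hw)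
      · exact lt_irrefl _ hz
      · exact absurd ((hcmp b a hab ha.1).2 hw.le) (not_le.2 hz)
    have hDD : D = D' := by
      rcases hnest with hs | hs
      · exact Finset.eq_of_subset_of_card_le hs hcard.ge
      · exact (Finset.eq_of_subset_of_card_le hs hcard.le).symm
    have := Finset.ext_iff.1 hDD r
    simpa [hD, hD', hr] using this

variable {X : Set ℝ} {f : X → X} {μ : Measure X}

lemma ordIdx_lt (f : X → X) (d l : ℕ) (x : X) : ordIdx f d l x < l + 1 :=
  Nat.lt_succ_of_le ((Finset.card_filter_le _ _).trans (Finset.card_range l).le)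

/-- The ordinal pattern of order `d` realized by a point. -/
def ordPattern (f : X → X) (d : ℕ) (x : X) (l : Fin d) : Fin (l.val + 2) :=
  ⟨ordIdx f d (l.val + 1) x, ordIdx_lt f d _ x⟩

lemma measurableSet_fibre_ordPattern (hf : Measurable f) (d : ℕ)
    (i : ∀ l : Fin d, Fin (l.val + 2)) : MeasurableSet (ordPattern f d ⁻¹' {i}) := by
  have hidx : ∀ l, Measurable (ordIdx f d l) := by
    intro l
    have : ordIdx f d l = fun x => ∑ r ∈ Finset.range l,
        {x | f^[d - r] x ≤ f^[d - l] x}.indicator (fun _ => 1) x := by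
      ext x
      rw [ordIdx, Finset.card_filter]
      rfl
    rw [this]
    exact Finset.measurable_fun_sum _ fun r _ =>
      measurable_const.indicator (measurableSet_le (hf.iterate _) (hf.iterate _))
  have : ordPattern f d ⁻¹' {i} = ⋂ l : Fin d, ordIdx f d (l.val + 1) ⁻¹' {(i l).val} := by
    ext x
    simp [ordPattern, funext_iff, Fin.ext_iff]
  rw [this]
  exact MeasurableSet.iInter fun l => hidx _ (measurableSet_singleton _)

lemma iterate_le_iff_of_ordPattern_eq {d : ℕ} {x y : X} (h : ordPattern f d x = ordPattern f d y)
    {s t : ℕ} (hst : s ≤ t) (ht : t ≤ d) : f^[t] x ≤ f^[s] x ↔ f^[t] y ≤ f^[s] y := by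
  rcases hst.eq_or_lt with rfl | hst
  · simp
  have key := le_iff_le_of_card_eq (z := fun r => f^[d - r] x) (w := fun r => f^[d - r] y) (d := d)
    (fun l h1 hl => by
      have := congrArg Fin.val (congrFun h ⟨l - 1, by omega⟩)
      simpa [ordPattern, ordIdx, Nat.sub_add_cancel h1] using this)
    (l := d - s) (r := d - t) (Nat.sub_le _ _) (by omega)
  simpa [Nat.sub_sub_self ht, Nat.sub_sub_self (hst.le.trans ht)] using key

/-- The itinerary of a labelling by comparisons is a function of the ordinal pattern. -/
lemma itinerary_orbitCmp_factorsThrough {α : Type*} {d : ℕ} (ψ : (Fin d → Prop) → α) (n : ℕ) :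
    (itinerary f (fun x => ψ (orbitCmp f d x)) n).FactorsThrough (ordPattern f (n + d)) := by
  intro x y h
  ext j
  refine congrArg ψ (funext fun t => propext ?_)
  unfold orbitCmp
  rw [← iterate_add_apply, ← iterate_add_apply]
  exact iterate_le_iff_of_ordPattern_eq h (by omega) (by omega)

lemma partEntropy_image_fibres {α : Type*} [Fintype α] (g : X → α) :
    partEntropy μ (Finset.univ.image fun a => g ⁻¹' {a}) = fnEntropy μ g := by
  unfold partEntropy
  rw [Finset.sum_image_of_disjoint (by simp)]
  · rfl
  · intro a _ b _ hab
    exact Disjoint.preimage g (Set.disjoint_singleton.2 hab)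

lemma partEntropy_patPartition (d : ℕ) :
    partEntropy μ (patPartition f d) = fnEntropy μ (ordPattern f d) := by
  rw [← partEntropy_image_fibres]
  refine congrArg _ (Finset.image_congr fun i _ => ?_)
  ext x
  simp [ordPattern, funext_iff, Fin.ext_iff]

lemma exists_label {𝒜 : Finset (Set X)} (h𝒜 : IsFinPartition 𝒜) :
    ∃ g : X → 𝒜, ∀ A : 𝒜, g ⁻¹' {A} = A := by
  have hex : ∀ x : X, ∃ A : 𝒜, x ∈ (A : Set X) := fun x => by
    obtain ⟨A, hA, hx⟩ := h𝒜.2.2.symm ▸ mem_univ x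
    exact ⟨⟨A, hA⟩, hx⟩
  choose g hg using hex
  refine ⟨g, fun A => Set.ext fun x => ⟨?_, fun hx => ?_⟩⟩
  · rintro rfl
    exact hg x
  · by_contra hne
    exact Set.disjoint_left.1 (h𝒜.2.1 _ (g x).2 _ A.2 fun h => hne (Subtype.ext h)) (hg x) hx

lemma dynRefine_eq_image {𝒜 : Finset (Set X)} {g : X → 𝒜} (hg : ∀ A : 𝒜, g ⁻¹' {A} = A) (n : ℕ) :
    dynRefine f 𝒜 n = Finset.univ.image fun w => itinerary f g n ⁻¹' {w} := by
  induction n with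
  | zero =>
    ext S
    simp only [dynRefine, Finset.mem_singleton, Finset.mem_image, Finset.mem_univ, true_and]
    have : ∀ w : Fin 0 → 𝒜, itinerary f g 0 ⁻¹' {w} = univ := fun w => by
      ext x; simp [Subsingleton.elim _ w]
    simp [this, eq_comm]
  | succ n ih =>
    have hsplit : ∀ (w : Fin n → 𝒜) (A : 𝒜), itinerary f g (n + 1) ⁻¹' {Fin.snoc w A} =
        itinerary f g n ⁻¹' {w} ∩ f^[n] ⁻¹' A := by
      intro w A
      rw [← hg A]
      ext x
      simp [funext_iff, itinerary, Fin.forall_fin_succ']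
    ext S
    simp only [dynRefine, ih, Finset.mem_image, Finset.mem_product, Finset.mem_univ, true_and,
      Prod.exists]
    constructor
    · rintro ⟨_, _, ⟨⟨w, rfl⟩, A, hA, rfl⟩, rfl⟩
      exact ⟨Fin.snoc w ⟨A, hA⟩, hsplit w ⟨A, hA⟩⟩
    · rintro ⟨w, rfl⟩
      refine ⟨_, _, ⟨⟨Fin.init w, rfl⟩, w (Fin.last n), (w (Fin.last n)).2, rfl⟩, ?_⟩
      rw [← hsplit, Fin.snoc_init_self]

end OrdinalPatterns

/-- For an ergodic system, the Kolmogorov-Sinai entropy does not exceed the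
permutation entropy: `h_μ(f) ≤ h*_μ(f)`. -/
theorem ksEntropy_le_permEntropy_ergodic
    {X : Set ℝ} (f : X → X) (μ : Measure X) [IsProbabilityMeasure μ]
    (hf : Ergodic f μ) :
    ksEntropy μ f ≤ permEntropy μ f := by
  have hmp := hf.toMeasurePreserving
  refine iSup₂_le fun 𝒜 h𝒜 => le_of_forall_gt_imp_ge_of_dense fun c hc => ?_
  rcases eq_or_ne c ⊤ with rfl | hctop
  · exact le_top
  obtain ⟨c', hc', hcc'⟩ := exists_between hc
  obtain ⟨g, hg⟩ := exists_label h𝒜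
  have hgm : ∀ A : 𝒜, MeasurableSet (g ⁻¹' {A}) := fun A => by
    rw [hg]; exact h𝒜.1 _ A.2
  have hc'top : c' ≠ ⊤ := hcc'.ne_top
  have hreal : c'.toReal < c.toReal := (ENNReal.toReal_lt_toReal hc'top hctop).2 hcc'
  set η := (c.toReal - c'.toReal) / 2 with hη
  have hη0 : 0 < η := by rw [hη]; linarith
  obtain ⟨d, ψ, hψ⟩ : ∃ (d : ℕ) (ψ : (Fin d → Prop) → 𝒜),
      fnEntropy μ (fun x => (g x, ψ (orbitCmp f d x))) -
        fnEntropy μ (fun x => ψ (orbitCmp f d x)) < η := by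
    choose d ψ h using fun k : ℕ => exists_orbitCmp_approx hf hgm (Nat.one_div_pos_of_nat (n := k))
    have hlim := tendsto_fnEntropy_prodMk_sub (μ := μ) (g := g)
      (c := fun k x => ψ k (orbitCmp f (d k) x)) (squeeze_zero (fun _ => measureReal_nonneg)
        (fun k => (h k).le) tendsto_one_div_add_atTop_nhds_zero_nat)
    obtain ⟨k, hk⟩ := (hlim.eventually_lt_const hη0).exists
    exact ⟨d k, ψ k, hk⟩
  have hperm : ∀ᶠ m : ℕ in atTop, fnEntropy μ (ordPattern f m) ≤ c'.toReal * m := by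
    filter_upwards [eventually_lt_of_limsup_lt hc', eventually_gt_atTop 0] with m hm hm0
    rw [partEntropy_patPartition] at hm
    have hm' : ENNReal.ofReal (fnEntropy μ (ordPattern f m)) ≤ c' * m :=
      (ENNReal.div_le_iff (by simpa using hm0.ne') (ENNReal.natCast_ne_top m)).1 hm.le
    have := ENNReal.toReal_mono (ENNReal.mul_ne_top hc'top (ENNReal.natCast_ne_top m)) hm'
    rwa [ENNReal.toReal_ofReal (fnEntropy_nonneg _), ENNReal.toReal_mul,
      ENNReal.toReal_natCast] at this
  have hev : ∀ᶠ n : ℕ in atTop, partEntropy μ (dynRefine f 𝒜 n) / n ≤ c.toReal := by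
    have hsmall : Tendsto (fun n : ℕ => c'.toReal * d / (n : ℝ)) atTop (𝓝 0) :=
      tendsto_const_div_atTop_nhds_zero_nat _
    filter_upwards [(tendsto_add_atTop_nat d).eventually hperm, eventually_gt_atTop 0,
      hsmall.eventually_lt_const hη0] with n hn hn0 hnη
    have hn0' : (0 : ℝ) < n := Nat.cast_pos.2 hn0
    rw [div_lt_iff₀ hn0'] at hnη
    rw [dynRefine_eq_image hg, partEntropy_image_fibres, div_le_iff₀ hn0']
    have h1 := fnEntropy_itinerary_le hmp hgm
      (measurableSet_fibre_comp (measurableSet_fibre_orbitCmp hf.measurable d) ψ) n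
    have h2 := fnEntropy_le_of_factorsThrough (μ := μ)
      (measurableSet_fibre_ordPattern hf.measurable (n + d))
      (itinerary_orbitCmp_factorsThrough ψ n)
    have h3 := mul_le_mul_of_nonneg_left hψ.le hn0'.le
    push_cast at hn
    have h4 : c.toReal = c'.toReal + 2 * η := by rw [hη]; ring
    rw [h4]
    nlinarith
  refine ENNReal.ofReal_le_of_le_toReal (limsup_le_of_le ?_ hev)
  refine IsCoboundedUnder.of_frequently_ge (a := 0) (Frequently.of_forall fun n => ?_)
  rw [dynRefine_eq_image hg, partEntropy_image_fibres]
  exact div_nonneg (fnEntropy_nonneg _) n.cast_nonneg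
end
end

section
/- Let X ⊆ ℝ, let f : X → X be Borel measurable, and let μ be an f-invariant ergodic Borel probability measure on X. Then the σ-algebra ⋁_{d∈ℕ} P_d generated by all ordinal-pattern partitions P_d, d ∈ ℕ, generates the Borel σ-algebra B(X) modulo μ-null sets: for each B ∈ B(X) there exists A ∈ ⋁_{d∈ℕ} P_d with μ(A Δ B) = 0, where Δ denotes the symmetric difference. -/
open MeasureTheory Filter Set Function
open scoped Classical ENNReal Topology symmDiff

noncomputable section

/-- The σ-algebra `⋁_{d∈ℕ} P_d` on `X` generated by all the ordinal pattern
partitions `P_d`, i.e. generated by all the sets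
`P_i = {x ∈ X : i_d(x) = i}` for `d ∈ ℕ` and patterns `i`. -/
def patSigma {X : Set ℝ} (f : X → X) : MeasurableSpace X :=
  MeasurableSpace.generateFrom
    {P : Set X | ∃ d : ℕ, 1 ≤ d ∧ ∃ i : ℕ → ℕ,
      P = {x : X | ∀ l : ℕ, 1 ≤ l → l ≤ d → ordIdx f d l x = i l}}

/-- **Mean ergodic theorem** in measure: for an ergodic map, the Birkhoff averages of a square
integrable function converge in measure to its integral. -/
theorem Ergodic.tendstoInMeasure_birkhoffAverage {α : Type*} [MeasurableSpace α] {μ : Measure α}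
    [IsProbabilityMeasure μ] {f : α → α} (hf : Ergodic f μ) {g : α → ℝ} (hg : MemLp g 2 μ) :
    TendstoInMeasure μ (fun n => birkhoffAverage ℝ f g n) atTop (fun _ => ∫ x, g x ∂μ) := by
  have hfm := hf.toMeasurePreserving
  let U : Lp ℝ 2 μ →L[ℝ] Lp ℝ 2 μ :=
    (Lp.compMeasurePreservingₗᵢ ℝ f hfm).toContinuousLinearMap
  have hU : ∀ h : Lp ℝ 2 μ, U h =ᵐ[μ] h ∘ f := fun h => Lp.coeFn_compMeasurePreserving h hfm
  have hU1 : ‖U‖ ≤ 1 := LinearIsometry.norm_toContinuousLinearMap_le _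
  set G : Lp ℝ 2 μ := hg.toLp g
  have hiter : ∀ n : ℕ, U^[n] G =ᵐ[μ] g ∘ f^[n] := by
    intro n
    induction n with
    | zero => exact hg.coeFn_toLp
    | succ n ih =>
      rw [iterate_succ_apply', iterate_succ, ← comp_assoc]
      exact (hU _).trans (hfm.quasiMeasurePreserving.ae_eq_comp ih)
  have havg : ∀ n : ℕ, (birkhoffAverage ℝ U _root_.id n G : Lp ℝ 2 μ) =ᵐ[μ] birkhoffAverage ℝ f g n := by
    intro n
    have hsum : ∀ n : ℕ, (birkhoffSum U _root_.id n G : Lp ℝ 2 μ) =ᵐ[μ] birkhoffSum f g n := by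
      intro n
      induction n with
      | zero => simpa using Lp.coeFn_zero ℝ 2 μ
      | succ n ih =>
        rw [birkhoffSum_succ]
        filter_upwards [Lp.coeFn_add (birkhoffSum U _root_.id n G) (_root_.id (U^[n] G)), ih,
          hiter n] with x h1 h2 h3
        rw [h1, birkhoffSum_succ, Pi.add_apply, h2]
        simp only [id_eq, h3, comp_apply]
    filter_upwards [hsum n, Lp.coeFn_smul ((n : ℝ)⁻¹) (birkhoffSum U _root_.id n G)] with x h1 h2
    simp only [birkhoffAverage]
    rw [h2, Pi.smul_apply, h1]
  let K := U.eqLocus (1 : Lp ℝ 2 μ →L[ℝ] Lp ℝ 2 μ)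
  set P : Lp ℝ 2 μ := (K.orthogonalProjectionOnto G : Lp ℝ 2 μ)
  have hlim : Tendsto (birkhoffAverage ℝ U _root_.id · G) atTop (𝓝 P) :=
    U.tendsto_birkhoffAverage_orthogonalProjection hU1 G
  have hPU : U P = P := (K.orthogonalProjectionOnto G).2
  obtain ⟨c, hc⟩ := hf.ae_eq_const_of_ae_eq_comp_ae (Lp.aestronglyMeasurable P)
    ((hU P).symm.trans (by rw [hPU]))
  let e : Lp ℝ 2 μ := indicatorConstLp 2 MeasurableSet.univ (measure_ne_top μ univ) (1 : ℝ)
  have heK : e ∈ K := by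
    change U e = e
    refine Lp.ext ((hU e).trans ?_)
    have he : e =ᵐ[μ] fun _ => (1 : ℝ) := by
      filter_upwards [indicatorConstLp_coeFn (p := 2) (hs := MeasurableSet.univ)
        (hμs := measure_ne_top μ univ) (c := (1 : ℝ))] with x hx
      simp only [e, hx, indicator_univ]
    exact (hfm.quasiMeasurePreserving.ae_eq_comp he).trans he.symm
  have hint : ∀ h : Lp ℝ 2 μ, inner ℝ e h = ∫ x, h x ∂μ := fun h => by
    rw [L2.inner_indicatorConstLp_one, setIntegral_univ]
  have hcg : c = ∫ x, g x ∂μ := by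
    have h0 : inner ℝ e (G - P) = 0 :=
      K.sub_starProjection_mem_orthogonal G e heK
    rw [inner_sub_right, hint, hint, integral_congr_ae hc, integral_congr_ae hg.coeFn_toLp] at h0
    simp only [const_apply, integral_const, probReal_univ, one_smul] at h0
    linarith
  refine (tendstoInMeasure_of_tendsto_Lp hlim).congr havg ?_
  rw [← hcg]
  exact hc

theorem Real.exists_countable_subset_forall_exists_le (T : Set ℝ) :
    ∃ D ⊆ T, D.Countable ∧ ∀ x ∈ T, ∃ u ∈ D, u ≤ x := by
  have hch : ∀ q : {q : ℚ // ∃ y ∈ T, y < q}, ∃ y ∈ T, y < (q : ℚ) := fun q => q.2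
  choose y hyT hyq using hch
  refine ⟨{x | IsLeast T x} ∪ range y, ?_, ?_, fun x hx => ?_⟩
  · rintro x (hx | ⟨q, rfl⟩)
    exacts [hx.1, hyT q]
  · have hs : {x | IsLeast T x}.Subsingleton := fun a ha b hb => ha.unique hb
    exact hs.countable.union (countable_range y)
  · by_cases hl : IsLeast T x
    · exact ⟨x, Or.inl hl, le_rfl⟩
    · obtain ⟨z, hz, hzx⟩ : ∃ z ∈ T, z < x := by
        by_contra! h
        exact hl ⟨hx, h⟩
      obtain ⟨q, hzq, hqx⟩ := exists_rat_btwn hzx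
      exact ⟨y ⟨q, z, hz, hzq⟩, Or.inr ⟨_, rfl⟩, ((hyq ⟨q, z, hz, hzq⟩).trans hqx).le⟩

theorem Real.exists_countable_subset_forall_exists_ge (T : Set ℝ) :
    ∃ D ⊆ T, D.Countable ∧ ∀ x ∈ T, ∃ u ∈ D, x ≤ u := by
  obtain ⟨D, hDT, hD, h⟩ := Real.exists_countable_subset_forall_exists_le (-T)
  refine ⟨-D, fun x hx => by simpa using hDT hx, hD.preimage neg_injective, fun x hx => ?_⟩
  obtain ⟨u, hu, hux⟩ := h (-x) (by simpa using hx)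
  exact ⟨-u, by simpa using hu, by linarith⟩

theorem measurable_ordIdx_self {X : Set ℝ} (f : X → X) (d : ℕ) :
    Measurable[patSigma f] (ordIdx f d d) := by
  let _ : MeasurableSpace X := patSigma f
  rcases Nat.eq_zero_or_pos d with rfl | hd
  · exact measurable_const (a := 0)
  have h : Measurable fun (x : X) (l : Finset.Icc 1 d) => ordIdx f d l x := by
    refine measurable_to_countable' fun i => MeasurableSpace.measurableSet_generateFrom
      ⟨d, hd, fun l => if h : l ∈ Finset.Icc 1 d then i ⟨l, h⟩ else 0, ?_⟩
    ext x
    simp only [mem_preimage, mem_singleton_iff, funext_iff, Subtype.forall, Finset.mem_Icc,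
      Set.mem_ofPred_eq]
    constructor
    · intro h l h1 h2
      rw [dif_pos ⟨h1, h2⟩]
      exact h l ⟨h1, h2⟩
    · intro h l hl
      have := h l hl.1 hl.2
      rwa [dif_pos hl] at this
  exact (measurable_pi_apply (⟨d, Finset.mem_Icc.2 ⟨hd, le_rfl⟩⟩ : Finset.Icc 1 d)).comp h

theorem ordIdx_self_add_one {X : Set ℝ} (f : X → X) (d : ℕ) (x : X) :
    ordIdx f d d x + 1 = ((Finset.range (d + 1)).filter fun s => f^[s] x ≤ x).card := by
  have h := Finset.sum_range_reflect (fun s => if f^[s] x ≤ x then 1 else 0) (d + 1)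
  simp only [ordIdx, Finset.card_filter, Nat.sub_self, iterate_zero, id_eq]
  rw [← h, Finset.sum_range_succ]
  simp

theorem birkhoffSum_indicator_one {α : Type*} (f : α → α) (s : Set α) (n : ℕ) (x : α) :
    birkhoffSum f (s.indicator (1 : α → ℝ)) n x
      = ((Finset.range n).filter fun k => f^[k] x ∈ s).card := by
  simp [birkhoffSum, indicator_apply, Finset.sum_boole]

/-- Two half-lines separated by a set of positive measure can be separated, up to null sets, by a
set in the σ-algebra generated by the ordinal patterns. -/
theorem exists_measurableSet_patSigma_separating {X : Set ℝ} {f : X → X} {μ : Measure X}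
    [IsProbabilityMeasure μ] (hf : Ergodic f μ) {c u : ℝ} (hcu : c < u)
    (hμ : μ {x : X | c < x ∧ (x : ℝ) ≤ u} ≠ 0) :
    ∃ A : Set X, MeasurableSet[patSigma f] A ∧ (∀ᵐ x : X ∂μ, (x : ℝ) ≤ c → x ∈ A) ∧
      ∀ᵐ x : X ∂μ, u ≤ (x : ℝ) → x ∉ A := by
  let S : ℝ → Set X := fun a => {x | (x : ℝ) ≤ a}
  have hS : ∀ a, MeasurableSet (S a) := fun a => measurable_subtype_coe measurableSet_Iic
  have hconv : ∀ a, TendstoInMeasure μ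
      (fun n => birkhoffAverage ℝ f ((S a).indicator (1 : X → ℝ)) n) atTop
      (fun _ => μ.real (S a)) := fun a => by
    have h := hf.tendstoInMeasure_birkhoffAverage
      (g := (S a).indicator (1 : X → ℝ)) (memLp_indicator_const 2 (hS a) 1 (Or.inr (by finiteness)))
    rwa [integral_indicator_one (hS a)] at h
  have hlt : μ.real (S c) < μ.real (S u) := by
    have hd : S u = S c ∪ {x : X | c < x ∧ (x : ℝ) ≤ u} := by
      ext x
      simp only [S, Set.mem_ofPred_eq, Set.mem_union]
      constructor
      · intro h
        rcases le_or_gt (x : ℝ) c with h' | h'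
        exacts [Or.inl h', Or.inr ⟨h', h⟩]
      · rintro (h | h)
        exacts [h.trans hcu.le, h.2]
    have hm : MeasurableSet {x : X | c < x ∧ (x : ℝ) ≤ u} :=
      measurable_subtype_coe measurableSet_Ioc
    have hdis : Disjoint (S c) {x : X | c < x ∧ (x : ℝ) ≤ u} :=
      Set.disjoint_left.2 fun x h1 h2 => not_lt.2 h1 h2.1
    rw [hd, measureReal_union hdis hm]
    have : 0 < μ.real {x : X | c < x ∧ (x : ℝ) ≤ u} :=
      ENNReal.toReal_pos hμ (measure_ne_top _ _)
    linarith
  obtain ⟨t, hct, htu⟩ := exists_between hlt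
  obtain ⟨n₁, hn₁, h₁⟩ := (hconv c).exists_seq_tendsto_ae
  have hconv_u : TendstoInMeasure μ
      (fun k => birkhoffAverage ℝ f ((S u).indicator (1 : X → ℝ)) (n₁ k)) atTop
      (fun _ => μ.real (S u)) := (hconv u).comp hn₁.tendsto_atTop
  obtain ⟨n₂, hn₂, h₂⟩ := hconv_u.exists_seq_tendsto_ae
  let N : ℕ → ℕ := fun k => n₁ (n₂ k)
  have hN : Tendsto N atTop atTop := (hn₁.comp hn₂).tendsto_atTop
  let R : ℕ → X → ℝ := fun n x => (n : ℝ)⁻¹ * ((ordIdx f (n - 1) (n - 1) x + 1 : ℕ) : ℝ)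
  have hR : ∀ n, 1 ≤ n → ∀ x : X,
      R n x = (n : ℝ)⁻¹ * ((Finset.range n).filter fun s => f^[s] x ≤ x).card := by
    intro n hn x
    simp only [R]
    rw [ordIdx_self_add_one, Nat.sub_add_cancel hn]
  have hav : ∀ a n x, birkhoffAverage ℝ f ((S a).indicator (1 : X → ℝ)) n x
      = (n : ℝ)⁻¹ * ((Finset.range n).filter fun s => (f^[s] x : ℝ) ≤ a).card := by
    intro a n x
    rw [birkhoffAverage, birkhoffSum_indicator_one, smul_eq_mul]
    rfl
  refine ⟨{x | ∀ᶠ k in atTop, R (N k) x < t}, ?_, ?_, ?_⟩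
  · let _ : MeasurableSpace X := patSigma f
    have hRm : ∀ n, Measurable (R n) := fun n =>
      (Measurable.of_discrete (f := fun m : ℕ => (n : ℝ)⁻¹ * ((m + 1 : ℕ) : ℝ))).comp
        (measurable_ordIdx_self f (n - 1))
    simp only [eventually_atTop, Set.ofPred_exists, Set.ofPred_forall]
    exact .iUnion fun _ => .iInter fun k => .iInter fun _ => hRm (N k) measurableSet_Iio
  · filter_upwards [h₁] with x hx hxc
    filter_upwards [(hx.comp hn₂.tendsto_atTop).eventually_lt_const hct,
      hN.eventually_ge_atTop 1] with k hk hk1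
    refine lt_of_le_of_lt ?_ hk
    rw [comp_apply, hav, hR _ hk1]
    refine mul_le_mul_of_nonneg_left ?_ (by positivity)
    exact_mod_cast Finset.card_le_card (Finset.monotone_filter_right _
      fun s _ hs => le_trans (Subtype.coe_le_coe.2 hs) hxc)
  · filter_upwards [h₂] with x hx hxu hA
    obtain ⟨k, ⟨hk, hk1⟩, hkA⟩ := (((hx.eventually_const_lt htu).and
      (hN.eventually_ge_atTop 1)).and hA).exists
    refine absurd (hk.trans_le ?_) (not_lt.2 hkA.le)
    rw [hav, hR _ hk1]
    refine mul_le_mul_of_nonneg_left ?_ (by positivity)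
    exact_mod_cast Finset.card_le_card (Finset.monotone_filter_right _
      fun s _ hs => Subtype.coe_le_coe.1 (le_trans hs hxu))

theorem exists_measurableSet_patSigma_ae_eq_Iic {X : Set ℝ} {f : X → X} {μ : Measure X}
    [IsProbabilityMeasure μ] (hf : Ergodic f μ) (c : ℝ) :
    ∃ A : Set X, MeasurableSet[patSigma f] A ∧ ((↑) ⁻¹' Iic c : Set X) =ᵐ[μ] A := by
  let I : ℝ → Set X := fun u => {x | c < x ∧ (x : ℝ) ≤ u}
  obtain ⟨D, hDT, hD, hDle⟩ :=
    Real.exists_countable_subset_forall_exists_le {u | c < u ∧ μ (I u) ≠ 0}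
  obtain ⟨E, hET, hE, hEge⟩ := Real.exists_countable_subset_forall_exists_ge {u | μ (I u) = 0}
  choose! A hAm hAc hAu using fun u (hu : u ∈ D) =>
    exists_measurableSet_patSigma_separating hf (hDT hu).1 (hDT hu).2
  refine ⟨⋂ u ∈ D, A u, MeasurableSet.biInter hD hAm, eventuallyEq_set.2 ?_⟩
  have h1 : ∀ᵐ x : X ∂μ, ∀ u ∈ D, (x : ℝ) ≤ c → x ∈ A u := (ae_ball_iff hD).2 hAc
  have h2 : ∀ᵐ x : X ∂μ, ∀ u ∈ D, u ≤ (x : ℝ) → x ∉ A u := (ae_ball_iff hD).2 hAu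
  have h3 : ∀ᵐ x : X ∂μ, ∀ u ∈ E, x ∉ I u :=
    (ae_ball_iff hE).2 fun u hu => measure_eq_zero_iff_ae_notMem.1 (hET hu)
  filter_upwards [h1, h2, h3] with x hx1 hx2 hx3
  simp only [mem_preimage, mem_Iic, mem_iInter]
  refine ⟨fun h u hu => hx1 u hu h, fun h => ?_⟩
  by_contra! hcx
  by_cases h0 : μ (I x) = 0
  · obtain ⟨u, hu, hxu⟩ := hEge x h0
    exact hx3 u hu ⟨hcx, hxu⟩
  · obtain ⟨u, hu, hux⟩ := hDle x ⟨hcx, h0⟩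
    exact hx2 u hu hux (h u hu)

/-- In the ergodic case, the σ-algebra `⋁_{d∈ℕ} P_d` generated by all ordinal pattern
partitions generates the Borel σ-algebra modulo `μ`-null sets: for every Borel set `B`
there is `A ∈ ⋁_{d∈ℕ} P_d` with `μ(A Δ B) = 0`. -/
theorem patSigma_generates_mod_null
    {X : Set ℝ} (f : X → X) (μ : Measure X) [IsProbabilityMeasure μ]
    (hf : Ergodic f μ) :
    ∀ B : Set X, MeasurableSet B →
      ∃ A : Set X, MeasurableSet[patSigma f] A ∧ μ (A ∆ B) = 0 := by
  intro B hB
  have hle : (inferInstance : MeasurableSpace X) ≤ eventuallyMeasurableSpace (patSigma f) (ae μ) := by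
    rw [show (inferInstance : MeasurableSpace X) = MeasurableSpace.generateFrom
        (preimage (Subtype.val : X → ℝ) '' range Iic) by
      rw [← MeasurableSpace.comap_generateFrom, ← borel_eq_generateFrom_Iic,
        ← BorelSpace.measurable_eq]; rfl]
    refine MeasurableSpace.generateFrom_le ?_
    rintro _ ⟨_, ⟨c, rfl⟩, rfl⟩
    exact exists_measurableSet_patSigma_ae_eq_Iic hf c
  obtain ⟨A, hA, hBA⟩ := hle B hB
  exact ⟨A, hA, measure_symmDiff_eq_zero_iff.2 hBA.symm⟩
end
end

section
/- Let X ⊆ ℝ, let f : X → X be Borel measurable, and let d, n ∈ ℕ. Then the σ-algebra generated by the partition P_{d+n} contains the σ-algebra ⋁_{j=0}^{n−1} f^{−∘j}(P_d) generated by all the sets f^{−∘j}(P_i) with j ∈ {0,1,…,n−1} and i ∈ I_d. -/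
open MeasureTheory Filter Set Function
open scoped Classical ENNReal Topology

noncomputable section

/-- Inversion counts over `range l` determine the comparisons with the `l`-th entry, once the
comparisons among earlier entries agree (one implication). -/
theorem le_imp_le_of_card_filter_eq {α : Type*} [LinearOrder α] {v w : ℕ → α} {l : ℕ}
    (hcard : ((Finset.range l).filter (fun r => v r ≤ v l)).card =
      ((Finset.range l).filter (fun r => w r ≤ w l)).card)
    (hprev : ∀ s < l, ∀ r < s, (v r ≤ v s ↔ w r ≤ w s))
    {a : ℕ} (hal : a < l) (ha : v a ≤ v l) : w a ≤ w l := by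
  by_contra hwa
  have hss : (Finset.range l).filter (fun r => w r ≤ w l) ⊂
      (Finset.range l).filter (fun r => v r ≤ v l) := by
    rw [Finset.ssubset_iff_of_subset]
    · exact ⟨a, by simp [hal, ha], by simp [hwa]⟩
    · intro b hb
      simp only [Finset.mem_filter, Finset.mem_range] at hb ⊢
      obtain ⟨hbl, hb⟩ := hb
      have hba : w b < w a := lt_of_le_of_lt hb (not_le.mp hwa)
      refine ⟨hbl, le_trans ?_ ha⟩
      rcases lt_trichotomy b a with h | h | h
      · exact (hprev a hal b h).2 hba.le
      · exact absurd hba (by simp [h])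
      · exact le_of_not_ge fun hv => not_le.mpr hba ((hprev b hbl a h).1 hv)
  exact (Finset.card_lt_card hss).ne hcard.symm

/-- The inversion counts of a finite sequence determine all comparisons of its entries. -/
theorem le_iff_le_of_card_filter_eq {α : Type*} [LinearOrder α] {v w : ℕ → α} {N : ℕ}
    (hcard : ∀ l ≤ N, ((Finset.range l).filter (fun r => v r ≤ v l)).card =
      ((Finset.range l).filter (fun r => w r ≤ w l)).card) :
    ∀ l ≤ N, ∀ r < l, (v r ≤ v l ↔ w r ≤ w l) := by
  intro l
  induction l using Nat.strong_induction_on with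
  | _ l ih =>
    intro hl r hr
    have hprev : ∀ s < l, ∀ r < s, (v r ≤ v s ↔ w r ≤ w s) :=
      fun s hs => ih s hs (hs.le.trans hl)
    exact ⟨le_imp_le_of_card_filter_eq (hcard l hl) hprev hr,
      le_imp_le_of_card_filter_eq (hcard l hl).symm
        (fun s hs r hr => (hprev s hs r hr).symm) hr⟩

/-- The ordinal pattern of order `N` of `x` determines the ordinal pattern of order `d` of
`f^[j] x` whenever `d + j ≤ N`. -/
theorem ordIdx_iterate_eq_of_ordIdx_eq {X : Set ℝ} {f : X → X} {d j N : ℕ} (hN : d + j ≤ N)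
    {x y : X} (h : ∀ l ≤ N, ordIdx f N l x = ordIdx f N l y) {l : ℕ} (hl : l ≤ d) :
    ordIdx f d l (f^[j] x) = ordIdx f d l (f^[j] y) := by
  have key := le_iff_le_of_card_filter_eq (v := fun r => f^[N - r] x)
    (w := fun r => f^[N - r] y) h
  unfold ordIdx
  congr 1
  refine Finset.filter_congr fun r hr => ?_
  have hr := Finset.mem_range.mp hr
  have := key (N - (d - l + j)) (by omega) (N - (d - r + j)) (by omega)
  simp only [Nat.sub_sub_self (show d - l + j ≤ N by omega),
    Nat.sub_sub_self (show d - r + j ≤ N by omega)] at this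
  simpa only [Function.iterate_add_apply] using this

/-- Every point lies in an element of `patPartition f N`, all of whose points realize the same
inversion numbers. -/
theorem exists_mem_patPartition {X : Set ℝ} (f : X → X) (N : ℕ) (x : X) :
    ∃ A ∈ patPartition f N, x ∈ A ∧
      ∀ y ∈ A, ∀ l ≤ N, ordIdx f N l x = ordIdx f N l y := by
  have hlt (l : ℕ) : ordIdx f N (l + 1) x < l + 2 :=
    Nat.lt_succ_of_le ((Finset.card_filter_le _ _).trans (by simp))
  refine ⟨_, Finset.mem_image_of_mem _ (Finset.mem_univ fun l : Fin N => ⟨_, hlt l⟩),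
    fun _ => rfl, fun y hy l hl => ?_⟩
  cases l with
  | zero => simp [ordIdx]
  | succ l => exact (hy ⟨l, hl⟩).symm

/-- The σ-algebra generated by the partition `P_{d+n}` contains the σ-algebra
`⋁_{j=0}^{n-1} f^{-∘j}(P_d)` generated by all sets `f^{-∘j}(P_i)` with
`0 ≤ j ≤ n-1` and `i ∈ I_d`. -/
theorem join_le_patPartition_sigma
    {X : Set ℝ} (f : X → X) (hf : Measurable f) (d n : ℕ) (hd : 1 ≤ d) (hn : 1 ≤ n) :
    MeasurableSpace.generateFrom
        {S : Set X | ∃ j : ℕ, j < n ∧ ∃ A ∈ patPartition f d, S = f^[j] ⁻¹' A}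
      ≤ MeasurableSpace.generateFrom ((patPartition f (d + n) : Finset (Set X)) : Set (Set X)) := by
  refine MeasurableSpace.generateFrom_le ?_
  rintro _ ⟨j, hj, A, hA, rfl⟩
  obtain ⟨i, -, rfl⟩ := Finset.mem_image.mp hA
  set S := f^[j] ⁻¹' {x : X | ∀ l : Fin d, ordIdx f d (l.val + 1) x = (i l).val} with hS
  have hunion : S = ⋃₀ {B : Set X | B ∈ patPartition f (d + n) ∧ B ⊆ S} := by
    refine Subset.antisymm (fun x hx => ?_) (sUnion_subset fun B hB => hB.2)
    obtain ⟨B, hB, hxB, hpat⟩ := exists_mem_patPartition f (d + n) x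
    refine ⟨B, ⟨hB, fun y hy l => ?_⟩, hxB⟩
    rw [← ordIdx_iterate_eq_of_ordIdx_eq (by omega) (hpat y hy) l.isLt]
    exact hx l
  rw [hunion]
  refine MeasurableSet.sUnion
    ((patPartition f (d + n)).finite_toSet.subset fun B hB => hB.1).countable
    fun B hB => MeasurableSpace.measurableSet_generateFrom hB.1
end
end
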